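/- arXiv:1410.4429 — 3 statements merged into one kernel-verified Lean document; each statement's English description precedes it below -/
import Mathlib

section
/- There exists an absolute constant c > 0 with the following property. Let A ∈ ℝ^{d₁×n} and B ∈ ℝ^{d₂×n} be nonzero matrices with columns a₁,…,aₙ and b₁,…,bₙ, such that for every i ∈ [n] at least one of aᵢ, bᵢ is nonzero, let pᵢ = (‖aᵢ‖²/‖A‖_F² + ‖bᵢ‖²/‖B‖_F²)/2, and let X₁,…,X_m be i.i.d. random d₁×d₂ matrices with P(X₁ = (1/pᵢ)·aᵢbᵢᵀ) = pᵢ. For every ε ∈ (0,1), if m ≥ c·(max(sr(A), sr(B))/ε² + √(sr(A)·sr(B))/ε)·log(2 + min(sr(A), sr(B))), then P(‖(1/m)∑_{j=1}^m X_j − ABᵀ‖ > ε·‖A‖·‖B‖) ≤ 1/4. -/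
open Matrix MeasureTheory

/-- The spectral norm (ℓ₂ operator norm) of a real matrix. -/
noncomputable def specNorm {d n : ℕ} (M : Matrix (Fin d) (Fin n) ℝ) : ℝ :=
  ‖LinearMap.toContinuousLinearMap (Matrix.toEuclideanLin M)‖

/-- The Frobenius norm of a real matrix. -/
noncomputable def frobNorm {d n : ℕ} (M : Matrix (Fin d) (Fin n) ℝ) : ℝ :=
  Real.sqrt (∑ i, ∑ j, (M i j) ^ 2)

/-- The stable rank of a matrix: `‖M‖_F² / ‖M‖²`. -/
noncomputable def srank {d n : ℕ} (M : Matrix (Fin d) (Fin n) ℝ) : ℝ :=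
  frobNorm M ^ 2 / specNorm M ^ 2

/-- The Euclidean norm of a vector (e.g. a column of a matrix). -/
noncomputable def colNorm {d : ℕ} (v : Fin d → ℝ) : ℝ := Real.sqrt (∑ i, v i ^ 2)

open Filter Topology NormedSpace in
/-- Powers of nearby elements of a normed ring are close. -/
theorem norm_pow_sub_pow_le_mul {𝔸 : Type*} [NormedRing 𝔸] [NormOneClass 𝔸] {x y : 𝔸} {M : ℝ}
    (hM : 1 ≤ M) (hx : ‖x‖ ≤ M) (hy : ‖y‖ ≤ M) (N : ℕ) :
    ‖x ^ N - y ^ N‖ ≤ N * ‖x - y‖ * M ^ N := by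
  induction N with
  | zero => simp
  | succ k ih =>
    have hk : x ^ (k + 1) - y ^ (k + 1) = x ^ k * (x - y) + (x ^ k - y ^ k) * y := by
      rw [pow_succ, pow_succ]; noncomm_ring
    have h1 : ‖x ^ k * (x - y)‖ ≤ M ^ (k + 1) * ‖x - y‖ := by
      refine (norm_mul_le _ _).trans (mul_le_mul_of_nonneg_right ?_ (norm_nonneg _))
      calc ‖x ^ k‖ ≤ ‖x‖ ^ k := norm_pow_le x k
        _ ≤ M ^ k := by gcongr
        _ ≤ M ^ (k + 1) := pow_le_pow_right₀ hM (Nat.le_succ k)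
    have h2 : ‖(x ^ k - y ^ k) * y‖ ≤ k * ‖x - y‖ * M ^ k * M := by
      refine (norm_mul_le _ _).trans ?_
      gcongr
    rw [hk]
    refine (norm_add_le _ _).trans ?_
    push_cast
    calc _ ≤ M ^ (k + 1) * ‖x - y‖ + k * ‖x - y‖ * M ^ k * M := add_le_add h1 h2
      _ = _ := by ring

open Filter Topology NormedSpace in
/-- If `f 0 = 1` and `f` has derivative `D` at `0`, then `f (1 / N) ^ N` tends to `exp D`. -/
theorem tendsto_pow_exp_of_hasDerivAt {𝔸 : Type*} [NormedRing 𝔸] [NormOneClass 𝔸]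
    [NormedAlgebra ℝ 𝔸] [CompleteSpace 𝔸] {f : ℝ → 𝔸} {D : 𝔸} (hf0 : f 0 = 1)
    (hf : HasDerivAt f D 0) :
    Tendsto (fun N : ℕ => f ((N : ℝ)⁻¹) ^ N) atTop (𝓝 (exp D)) := by
  let : NormedAlgebra ℚ 𝔸 := NormedAlgebra.restrictScalars ℚ ℝ 𝔸
  let g : ℝ → 𝔸 := fun t => exp (t • D)
  have hg0 : g 0 = 1 := by simp [g]
  have hg : HasDerivAt g D 0 := by
    simpa using hasDerivAt_exp_smul_const (𝕂 := ℝ) D (0 : ℝ)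
  have hinv : Tendsto (fun N : ℕ => ((N : ℝ)⁻¹)) atTop (𝓝 0) :=
    tendsto_inv_atTop_nhds_zero_nat
  have hbound : ∀ h : ℝ → 𝔸, h 0 = 1 → HasDerivAt h D 0 →
      ∀ᶠ N : ℕ in atTop, ‖h ((N : ℝ)⁻¹)‖ ≤ Real.exp ((‖D‖ + 1) * (N : ℝ)⁻¹) := by
    intro h h0 hd
    have h1 := (hasDerivAt_iff_isLittleO.1 hd).def (zero_lt_one)
    filter_upwards [hinv.eventually h1] with N hN
    simp only [sub_zero, h0, one_mul] at hN
    have hN0 : (0 : ℝ) ≤ (N : ℝ)⁻¹ := by positivity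
    rw [Real.norm_of_nonneg hN0] at hN
    calc ‖h ((N : ℝ)⁻¹)‖
        = ‖(h ((N : ℝ)⁻¹) - 1 - (N : ℝ)⁻¹ • D) + 1 + (N : ℝ)⁻¹ • D‖ := by congr 1; abel
      _ ≤ (N : ℝ)⁻¹ + 1 + (N : ℝ)⁻¹ * ‖D‖ := by
          refine (norm_add_le _ _).trans (add_le_add ((norm_add_le _ _).trans ?_) ?_)
          · rw [norm_one]; exact add_le_add_left hN 1
          · rw [norm_smul, Real.norm_of_nonneg hN0]
      _ = (‖D‖ + 1) * (N : ℝ)⁻¹ + 1 := by ring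
      _ ≤ _ := Real.add_one_le_exp _
  have hexp : ∀ᶠ N : ℕ in atTop, exp D = g ((N : ℝ)⁻¹) ^ N := by
    filter_upwards [eventually_gt_atTop 0] with N hN
    simp only [g]
    rw [← NormedSpace.exp_nsmul, ← Nat.cast_smul_eq_nsmul ℝ, smul_smul, mul_inv_cancel₀ (by positivity),
      one_smul]
  have hdiff : Tendsto (fun N : ℕ => f ((N : ℝ)⁻¹) ^ N - g ((N : ℝ)⁻¹) ^ N) atTop (𝓝 0) := by
    rw [Metric.tendsto_nhds]
    intro ε hε
    have hlo := (hasDerivAt_iff_isLittleO.1 (hf.sub hg)).def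
      (c := ε / (2 * Real.exp (‖D‖ + 1))) (by positivity)
    filter_upwards [hinv.eventually hlo, hbound f hf0 hf, hbound g hg0 hg,
      eventually_gt_atTop 0] with N h1 h2 h3 hN
    have hN' : (0 : ℝ) < N := by exact_mod_cast hN
    simp only [Pi.sub_apply, hf0, hg0, sub_self, sub_zero, smul_zero] at h1
    rw [Real.norm_of_nonneg (by positivity)] at h1
    have h4 := norm_pow_sub_pow_le_mul (Real.one_le_exp (by positivity)) h2 h3 N
    rw [dist_zero_right]
    refine h4.trans_lt ?_
    rw [← Real.exp_nat_mul, show (N : ℝ) * ((‖D‖ + 1) * (N : ℝ)⁻¹) = ‖D‖ + 1 by field_simp]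
    calc _ ≤ N * (ε / (2 * Real.exp (‖D‖ + 1)) * (N : ℝ)⁻¹) * Real.exp (‖D‖ + 1) := by gcongr
      _ = ε / 2 := by field_simp
      _ < ε := by linarith
  have h5 := hdiff.add_const (exp D)
  rw [zero_add] at h5
  refine h5.congr' ?_
  filter_upwards [hexp] with N hN
  rw [← hN]; abel

namespace Matrix

/-- Cauchy–Schwarz for the trace pairing. -/
theorem trace_mul_sq_le {ι : Type*} [Fintype ι] (P Q : Matrix ι ι ℝ) :
    (P * Q).trace ^ 2 ≤ (Pᵀ * P).trace * (Qᵀ * Q).trace := by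
  have h1 : (P * Q).trace = ∑ x : ι × ι, P x.1 x.2 * Q x.2 x.1 := by
    simp [Matrix.trace, Matrix.mul_apply, Fintype.sum_prod_type]
  have h2 : (Pᵀ * P).trace = ∑ x : ι × ι, P x.1 x.2 ^ 2 := by
    rw [Matrix.trace_mul_comm]
    simp [Matrix.trace, Matrix.mul_apply, Fintype.sum_prod_type, sq]
  have h3 : (Qᵀ * Q).trace = ∑ x : ι × ι, Q x.2 x.1 ^ 2 := by
    simp [Matrix.trace, Matrix.mul_apply, Fintype.sum_prod_type, sq]
  rw [h1, h2, h3]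
  exact Finset.sum_mul_sq_le_sq_mul_sq _ _ _

variable {ι : Type*} [Fintype ι] [DecidableEq ι]

theorem trace_mul_pow_comm (P Q : Matrix ι ι ℝ) (n : ℕ) :
    ((P * Q) ^ n).trace = ((Q * P) ^ n).trace := by
  cases n with
  | zero => simp
  | succ n =>
    have h : Q * (P * Q) ^ n = (Q * P) ^ n * Q :=
      (SemiconjBy.pow_right (a := Q) (x := P * Q) (y := Q * P) (by simp [SemiconjBy, mul_assoc]) n).eq
    rw [pow_succ', mul_assoc, Matrix.trace_mul_comm, h, pow_succ, ← mul_assoc]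

/-- Hölder's inequality for the trace of an alternating product with a power of two factors. -/
theorem trace_mul_pow_two_pow_sq_le (k : ℕ) (P Q : Matrix ι ι ℝ) :
    ((P * Q) ^ 2 ^ k).trace ^ 2 ≤ ((Pᵀ * P) ^ 2 ^ k).trace * ((Qᵀ * Q) ^ 2 ^ k).trace := by
  induction k generalizing P Q with
  | zero => simpa using trace_mul_sq_le P Q
  | succ k ih =>
    have hd : ∀ M : Matrix ι ι ℝ, M ^ 2 ^ (k + 1) = (M * M) ^ 2 ^ k := fun M => by
      rw [pow_succ, mul_comm, pow_mul, sq]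
    have hnn : ∀ M : Matrix ι ι ℝ, 0 ≤ ((Mᵀ * M) ^ 2 ^ k).trace := fun M => by
      have := (posSemidef_conjTranspose_mul_self M).pow (2 ^ k)
      simpa [conjTranspose_eq_transpose_of_trivial] using this.trace_nonneg
    have h1 : |((P * Q) ^ 2 ^ (k + 1)).trace| ≤ (((P * Q)ᵀ * (P * Q)) ^ 2 ^ k).trace := by
      rw [hd]
      exact abs_le_of_sq_le_sq (by simpa [sq] using ih (P * Q) (P * Q)) (hnn _)
    have h2 : (((P * Q)ᵀ * (P * Q)) ^ 2 ^ k).trace = (((Pᵀ * P) * (Q * Qᵀ)) ^ 2 ^ k).trace := by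
      rw [transpose_mul, mul_assoc, trace_mul_pow_comm]
      simp only [mul_assoc]
    have h3 := ih (Pᵀ * P) (Q * Qᵀ)
    have h4 : ((Q * Qᵀ) ^ 2 ^ (k + 1)).trace = ((Qᵀ * Q) ^ 2 ^ (k + 1)).trace :=
      trace_mul_pow_comm _ _ _
    rw [← sq_abs, ← h4]
    refine (pow_le_pow_left₀ (abs_nonneg _) h1 2).trans ?_
    rw [h2, hd, hd (Q * Qᵀ)]
    simpa using h3

/-- For symmetric `A`, `B`, `tr (AB)^{2^k} ≤ tr A^{2^k} B^{2^k}`. -/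
theorem trace_mul_pow_two_pow_le (k : ℕ) {A B : Matrix ι ι ℝ} (hA : Aᵀ = A) (hB : Bᵀ = B) :
    ((A * B) ^ 2 ^ k).trace ≤ (A ^ 2 ^ k * B ^ 2 ^ k).trace := by
  induction k generalizing A B with
  | zero => simp
  | succ k ih =>
    have hd : ∀ M : Matrix ι ι ℝ, M ^ 2 ^ (k + 1) = (M ^ 2) ^ 2 ^ k := fun M => by
      rw [pow_succ, mul_comm, pow_mul]
    have hnn : 0 ≤ ((((A * B))ᵀ * (A * B)) ^ 2 ^ k).trace := by
      have := (posSemidef_conjTranspose_mul_self (A * B)).pow (2 ^ k)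
      simpa only [conjTranspose_eq_transpose_of_trivial] using this.trace_nonneg
    have h1 : ((A * B) ^ 2 ^ (k + 1)).trace ≤ (((A * B)ᵀ * (A * B)) ^ 2 ^ k).trace := by
      rw [hd, sq]
      exact le_of_sq_le_sq
        (by simpa only [sq] using trace_mul_pow_two_pow_sq_le k (A * B) (A * B)) hnn
    refine h1.trans ?_
    have h2 : (((A * B)ᵀ * (A * B)) ^ 2 ^ k).trace = ((A ^ 2 * B ^ 2) ^ 2 ^ k).trace := by
      rw [transpose_mul, hA, hB, mul_assoc, trace_mul_pow_comm, sq, sq]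
      simp only [mul_assoc]
    rw [h2, hd A, hd B]
    exact ih (by rw [transpose_pow, hA]) (by rw [transpose_pow, hB])

open scoped Matrix.Norms.Operator in
open Filter Topology NormedSpace in
/-- The Lie product formula. -/
theorem tendsto_exp_mul_exp_pow [Nonempty ι] (H K : Matrix ι ι ℝ) :
    Tendsto (fun N : ℕ => (exp ((N : ℝ)⁻¹ • H) * exp ((N : ℝ)⁻¹ • K)) ^ N) atTop
      (𝓝 (exp (H + K))) := by
  have : NormOneClass (Matrix ι ι ℝ) := ⟨by
    rw [← Matrix.diagonal_one, Matrix.linfty_opNorm_diagonal]; simp⟩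
  have h1 := hasDerivAt_exp_smul_const (𝕂 := ℝ) H (0 : ℝ)
  have h2 := hasDerivAt_exp_smul_const (𝕂 := ℝ) K (0 : ℝ)
  have h3 := h1.mul h2
  simp only [zero_smul, exp_zero, one_mul, mul_one] at h3
  exact tendsto_pow_exp_of_hasDerivAt (f := fun t : ℝ => exp (t • H) * exp (t • K)) (by simp)
    h3

open Filter Topology NormedSpace in
/-- The Golden–Thompson inequality for real symmetric matrices. -/
theorem trace_exp_add_le {H K : Matrix ι ι ℝ} (hH : Hᵀ = H) (hK : Kᵀ = K) :
    (exp (H + K)).trace ≤ (exp H * exp K).trace := by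
  cases isEmpty_or_nonempty ι with
  | inl h => simp [Matrix.trace]
  | inr h =>
    have h1 : Tendsto (fun k : ℕ => 2 ^ k) atTop (atTop : Filter ℕ) :=
      tendsto_pow_atTop_atTop_of_one_lt one_lt_two
    have h2 := (tendsto_exp_mul_exp_pow H K).comp h1
    have h3 : Continuous fun M : Matrix ι ι ℝ => M.trace := continuous_id.matrix_trace
    refine le_of_tendsto ((h3.tendsto _).comp h2) (Eventually.of_forall fun k => ?_)
    have hs : ∀ M : Matrix ι ι ℝ, exp ((((2 ^ k : ℕ) : ℝ)⁻¹) • M) ^ 2 ^ k = exp M := fun M => by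
      rw [← Matrix.exp_nsmul, ← Nat.cast_smul_eq_nsmul ℝ, smul_smul,
        mul_inv_cancel₀ (by positivity), one_smul]
    have h4 := trace_mul_pow_two_pow_le k
      (A := exp ((((2 ^ k : ℕ) : ℝ)⁻¹) • H)) (B := exp ((((2 ^ k : ℕ) : ℝ)⁻¹) • K))
      (by rw [← Matrix.exp_transpose, transpose_smul, hH])
      (by rw [← Matrix.exp_transpose, transpose_smul, hK])
    rw [hs, hs] at h4
    exact h4

end Matrix

namespace Matrix

/-- A combination of `exp H`, `1`, `H`, `H ^ 2` is positive semidefinite as soon as the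
corresponding scalar combination is nonnegative at the eigenvalues of `H`. -/
theorem IsHermitian.posSemidef_exp_add {ι : Type*} [Fintype ι] [DecidableEq ι]
    {H : Matrix ι ι ℝ} (hH : H.IsHermitian) {κ c₀ c₁ c₂ : ℝ}
    (h : ∀ i, 0 ≤ κ * Real.exp (hH.eigenvalues i) + c₀ + c₁ * hH.eigenvalues i
      + c₂ * hH.eigenvalues i ^ 2) :
    (κ • NormedSpace.exp H + c₀ • (1 : Matrix ι ι ℝ) + c₁ • H + c₂ • H ^ 2).PosSemidef := by
  set U : Matrix ι ι ℝ := (hH.eigenvectorUnitary : Matrix ι ι ℝ) with hU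
  set D : Matrix ι ι ℝ := diagonal hH.eigenvalues with hD
  have hUU : Uᴴ * U = 1 := by
    simpa [star_eq_conjTranspose] using Unitary.coe_star_mul_self hH.eigenvectorUnitary
  have hUU' : U * Uᴴ = 1 := by
    simpa [star_eq_conjTranspose] using Unitary.coe_mul_star_self hH.eigenvectorUnitary
  have hinv : U⁻¹ = Uᴴ := inv_eq_left_inv hUU
  have hunit : IsUnit U := IsUnit.of_mul_eq_one _ hUU'
  have hspec : H = U * D * Uᴴ := by
    have := hH.spectral_theorem
    rw [Unitary.conjStarAlgAut_apply] at this
    exact this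
  have hexp : NormedSpace.exp H = U * diagonal (fun i => Real.exp (hH.eigenvalues i)) * Uᴴ := by
    conv_lhs => rw [hspec, ← hinv, Matrix.exp_conj _ _ hunit, hinv, hD, Matrix.exp_diagonal]
    congr 3
    funext i
    rw [Pi.coe_exp, Real.exp_eq_exp_ℝ]
  have hsq : H ^ 2 = U * diagonal (fun i => hH.eigenvalues i ^ 2) * Uᴴ := by
    calc H ^ 2 = U * D * (Uᴴ * U) * D * Uᴴ := by
          conv_lhs => rw [hspec]
          simp only [sq, mul_assoc]
      _ = U * (D * D) * Uᴴ := by rw [hUU, mul_one, mul_assoc U D D]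
      _ = _ := by rw [hD, diagonal_mul_diagonal]; simp only [sq]
  have hmain : κ • NormedSpace.exp H + c₀ • (1 : Matrix ι ι ℝ) + c₁ • H + c₂ • H ^ 2
      = U * diagonal (fun i => κ * Real.exp (hH.eigenvalues i) + c₀ + c₁ * hH.eigenvalues i
      + c₂ * hH.eigenvalues i ^ 2) * Uᴴ := by
    have hsum : diagonal (fun i => κ * Real.exp (hH.eigenvalues i) + c₀ + c₁ * hH.eigenvalues i
      + c₂ * hH.eigenvalues i ^ 2) = κ • diagonal (fun i => Real.exp (hH.eigenvalues i))
        + c₀ • (1 : Matrix ι ι ℝ) + c₁ • D + c₂ • diagonal (fun i => hH.eigenvalues i ^ 2) := by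
      ext i j
      by_cases hij : i = j <;> simp [hD, hij]
    rw [hsum, hexp, hsq]
    simp only [mul_add, add_mul, mul_smul_comm, smul_mul_assoc, mul_one]
    rw [hUU', ← hspec]
  rw [hmain]
  exact (PosSemidef.diagonal h).mul_mul_conjTranspose_same U

theorem PosSemidef.trace_mul_nonneg {ι : Type*} [Fintype ι] {P Q : Matrix ι ι ℝ} (hP : P.PosSemidef)
    (hQ : Q.PosSemidef) : 0 ≤ (P * Q).trace := by
  obtain ⟨m, v, rfl⟩ := posSemidef_iff_eq_sum_vecMulVec.1 hP
  rw [Finset.sum_mul, trace_sum]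
  refine Finset.sum_nonneg fun i _ => ?_
  rw [trace_mul_comm, mul_vecMulVec, trace_vecMulVec, dotProduct_comm]
  exact hQ.dotProduct_mulVec_nonneg (v i)

variable {ι : Type*} [Fintype ι] [DecidableEq ι]

theorem IsHermitian.posSemidef_exp_sub_one_sub {H : Matrix ι ι ℝ} (hH : H.IsHermitian) :
    (NormedSpace.exp H - 1 - H).PosSemidef := by
  have h := hH.posSemidef_exp_add (κ := 1) (c₀ := -1) (c₁ := -1) (c₂ := 0) (fun i => by
    have := Real.add_one_le_exp (hH.eigenvalues i); linarith)
  convert h using 1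
  simp only [one_smul, neg_smul, zero_smul, add_zero, sub_eq_add_neg]

theorem IsHermitian.posSemidef_exp {H : Matrix ι ι ℝ} (hH : H.IsHermitian) :
    (NormedSpace.exp H).PosSemidef := by
  have h := hH.posSemidef_exp_add (κ := 1) (c₀ := 0) (c₁ := 0) (c₂ := 0) (fun i => by
    have := Real.exp_pos (hH.eigenvalues i); linarith)
  simpa using h

/-- `NormedSpace.exp Y ≤ 1 + Y + Y ^ 2` for symmetric `Y` of norm at most one. -/
theorem IsHermitian.posSemidef_one_add_add_sq_sub_exp {Y : Matrix ι ι ℝ} (hY : Y.IsHermitian)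
    (hle : ∀ x : ι → ℝ, |x ⬝ᵥ Y *ᵥ x| ≤ x ⬝ᵥ x) : (1 + Y + Y ^ 2 - NormedSpace.exp Y).PosSemidef := by
  have h := hY.posSemidef_exp_add (κ := -1) (c₀ := 1) (c₁ := 1) (c₂ := 1) (fun i => by
    have h1 : |hY.eigenvalues i| ≤ 1 := by
      have h2 := hle (hY.eigenvectorBasis i)
      rw [hY.mulVec_eigenvectorBasis, dotProduct_smul] at h2
      have h3 : (hY.eigenvectorBasis i).ofLp ⬝ᵥ (hY.eigenvectorBasis i).ofLp = 1 := by
        have h4 := hY.eigenvectorBasis.orthonormal.1 i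
        have h5 := real_inner_self_eq_norm_sq (hY.eigenvectorBasis i)
        rw [h4, EuclideanSpace.inner_eq_star_dotProduct] at h5
        simpa using h5
      simpa [h3] using h2
    have h2 := (abs_le.1 (Real.abs_exp_sub_one_sub_id_le h1)).2
    linarith)
  convert h using 1
  simp only [one_smul, neg_smul]
  abel

/-- A lower bound for `tr (NormedSpace.exp H - 1 - H)` from a lower bound for the
quadratic form of `H`. -/
theorem IsHermitian.le_trace_exp_sub_one_sub {H : Matrix ι ι ℝ} (hH : H.IsHermitian) {t : ℝ}
    (ht : 0 ≤ t) {x : ι → ℝ} (hx : x ⬝ᵥ x = 1) (hxt : t ≤ x ⬝ᵥ H *ᵥ x) :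
    Real.exp t - 1 - t ≤ (NormedSpace.exp H - 1 - H).trace := by
  have h1 := hH.posSemidef_exp_add (κ := 1) (c₀ := -1 - (Real.exp t - 1 - t) + (Real.exp t - 1) * t)
    (c₁ := -1 - (Real.exp t - 1)) (c₂ := 0) (fun i => by
      have h2 : Real.exp t * (hH.eigenvalues i - t + 1) ≤ Real.exp (hH.eigenvalues i) := by
        calc _ ≤ Real.exp t * Real.exp (hH.eigenvalues i - t) := by
              gcongr; exact Real.add_one_le_exp _
          _ = _ := by rw [← Real.exp_add]; ring_nf
      linarith)
  have h2 := h1.dotProduct_mulVec_nonneg x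
  have hE : (1 : ℝ) ≤ Real.exp t := Real.one_le_exp ht
  have h3 : Real.exp t - 1 - t ≤ x ⬝ᵥ (NormedSpace.exp H - 1 - H) *ᵥ x := by
    simp only [star_trivial, one_smul, zero_smul, add_zero, add_mulVec, smul_mulVec, one_mulVec,
      dotProduct_add, dotProduct_smul, hx, smul_eq_mul, mul_one] at h2
    simp only [sub_mulVec, one_mulVec, dotProduct_sub, hx]
    nlinarith [mul_nonneg (sub_nonneg.2 hE) (sub_nonneg.2 hxt)]
  refine h3.trans ?_
  have h4 : ((1 : Matrix ι ι ℝ) - vecMulVec x x).PosSemidef := by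
    refine PosSemidef.of_dotProduct_mulVec_nonneg ?_ fun y => ?_
    · rw [IsHermitian, conjTranspose_sub, conjTranspose_one]
      simp [conjTranspose_eq_transpose_of_trivial, transpose_vecMulVec]
    · have h5 : (x ⬝ᵥ y) ^ 2 ≤ (x ⬝ᵥ x) * (y ⬝ᵥ y) := by
        simpa [dotProduct, sq] using Finset.sum_mul_sq_le_sq_mul_sq Finset.univ x y
      rw [hx] at h5
      simp only [star_trivial, sub_mulVec, one_mulVec, dotProduct_sub, vecMulVec_mulVec,
        dotProduct_smul, MulOpposite.smul_eq_mul_unop, MulOpposite.unop_op]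
      rw [dotProduct_comm y x]
      nlinarith
  have h6 := hH.posSemidef_exp_sub_one_sub.trace_mul_nonneg h4
  rw [mul_sub, mul_one, trace_sub, mul_vecMulVec, trace_vecMulVec, dotProduct_comm] at h6
  linarith

end Matrix

/-- Conditioning a product-weighted sum over tuples on the first coordinate. -/
theorem sum_prod_mul_succ {α M : Type*} [Fintype α] [AddCommMonoid M] (p : α → ℝ) (Y : α → M)
    (h : M → ℝ) (m : ℕ) :
    ∑ ω : Fin (m + 1) → α, (∏ j, p (ω j)) * h (∑ j, Y (ω j))
      = ∑ ω : Fin m → α, (∏ j, p (ω j)) * ∑ i, p i * h (Y i + ∑ j, Y (ω j)) := by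
  rw [← (Fin.consEquiv fun _ => α).sum_comp, Fintype.sum_prod_type_right]
  refine Finset.sum_congr rfl fun ω _ => ?_
  rw [Finset.mul_sum]
  refine Finset.sum_congr rfl fun i _ => ?_
  simp only [Fin.consEquiv_apply, Fin.prod_univ_succ, Fin.sum_univ_succ, Fin.cons_zero,
    Fin.cons_succ]
  ring

theorem sum_prod_eq_one {α : Type*} [Fintype α] {p : α → ℝ} (hp : ∑ i, p i = 1) (m : ℕ) :
    ∑ ω : Fin m → α, ∏ j, p (ω j) = 1 := by
  induction m with
  | zero => simp
  | succ m ih =>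
    simpa [hp, ih] using sum_prod_mul_succ p (fun _ => (0 : ℝ)) (fun _ => 1) m

/-- A sum of independent centred variables has mean zero. -/
theorem sum_prod_mul_linear_eq_zero {α M : Type*} [Fintype α] [AddCommGroup M] [Module ℝ M]
    {p : α → ℝ} (hp : ∑ i, p i = 1) {Y : α → M} (hY : ∑ i, p i • Y i = 0) (L : M →ₗ[ℝ] ℝ)
    (m : ℕ) : ∑ ω : Fin m → α, (∏ j, p (ω j)) * L (∑ j, Y (ω j)) = 0 := by
  induction m with
  | zero => simp
  | succ m ih =>
    rw [sum_prod_mul_succ p Y L m]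
    have h1 : ∑ i, p i * L (Y i) = 0 := by
      have := congrArg L hY
      simpa using this
    rw [← ih]
    refine Finset.sum_congr rfl fun ω _ => ?_
    congr 1
    simp only [map_add, mul_add, Finset.sum_add_distrib, h1, ← Finset.sum_mul, hp]
    ring

namespace Matrix

variable {ι α : Type*} [Fintype ι] [DecidableEq ι] [Fintype α]

open NormedSpace in
/-- One step of the recursion for the trace exponential moment of a sum of independent centred
random symmetric matrices. -/
theorem sum_mul_trace_exp_add_le {p : α → ℝ} (hp0 : ∀ i, 0 ≤ p i) (hp : ∑ i, p i = 1)
    {Y : α → Matrix ι ι ℝ} (hY : ∀ i, (Y i).IsHermitian) (hmean : ∑ i, p i • Y i = 0)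
    (hle : ∀ i (x : ι → ℝ), |x ⬝ᵥ Y i *ᵥ x| ≤ x ⬝ᵥ x) {v τ : ℝ}
    (hv : (v • (1 : Matrix ι ι ℝ) - ∑ i, p i • Y i ^ 2).PosSemidef)
    (hτ : (∑ i, p i • Y i ^ 2).trace ≤ τ) {S : Matrix ι ι ℝ} (hS : S.IsHermitian) :
    ∑ i, p i * (exp (Y i + S) - 1 - (Y i + S)).trace
      ≤ (1 + v) * (exp S - 1 - S).trace + τ + (S * ∑ i, p i • Y i ^ 2).trace := by
  set W := ∑ i, p i • Y i ^ 2 with hW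
  have h1 : ∀ i, (exp (Y i + S)).trace ≤ (exp S * (1 + Y i + Y i ^ 2)).trace := by
    intro i
    have h2 := trace_exp_add_le (H := Y i) (K := S) (by simpa using (hY i).eq)
      (by simpa using hS.eq)
    have h3 := hS.posSemidef_exp.trace_mul_nonneg
      ((hY i).posSemidef_one_add_add_sq_sub_exp (hle i))
    rw [mul_sub, trace_sub] at h3
    rw [trace_mul_comm] at h2
    linarith
  have h4 : ∑ i, p i * (exp S * (1 + Y i + Y i ^ 2)).trace = (exp S).trace + (exp S * W).trace := by
    have h5 : ∑ i, p i • (1 + Y i + Y i ^ 2) = 1 + W := by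
      simp only [smul_add, Finset.sum_add_distrib, hmean, ← Finset.sum_smul, hp, one_smul, add_zero,
        hW]
    rw [show (exp S).trace + (exp S * W).trace = (exp S * (1 + W)).trace by
      rw [mul_add, mul_one, trace_add], ← h5, Finset.mul_sum, trace_sum]
    simp only [mul_smul_comm, trace_smul, smul_eq_mul]
  have h6 : ∑ i, p i * (1 + (Y i + S)).trace = (1 + S).trace := by
    rw [show (1 + S) = ∑ i, p i • (1 + (Y i + S)) by
      simp only [smul_add, Finset.sum_add_distrib, hmean, ← Finset.sum_smul, hp, one_smul,
        zero_add], trace_sum]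
    simp only [trace_smul, smul_eq_mul]
  have h7 : ∑ i, p i * (exp (Y i + S) - 1 - (Y i + S)).trace
      ≤ (exp S).trace + (exp S * W).trace - (1 + S).trace := by
    rw [← h4, ← h6, ← Finset.sum_sub_distrib]
    refine Finset.sum_le_sum fun i _ => ?_
    rw [← mul_sub, sub_sub, trace_sub]
    exact mul_le_mul_of_nonneg_left (sub_le_sub_right (h1 i) _) (hp0 i)
  have h8 := hS.posSemidef_exp_sub_one_sub.trace_mul_nonneg hv
  simp only [mul_sub, sub_mul, mul_smul_comm, mul_one, one_mul, trace_sub, trace_smul,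
    smul_eq_mul] at h8
  rw [trace_add] at h7
  have h9 : (exp S - 1 - S).trace = (exp S).trace - (1 : Matrix ι ι ℝ).trace - S.trace := by
    rw [trace_sub, trace_sub]
  rw [h9]
  linarith

open NormedSpace in
/-- Intrinsic-dimension bound for the trace exponential moment of a sum of independent centred
random symmetric matrices. -/
theorem sum_prod_mul_trace_exp_le {p : α → ℝ} (hp0 : ∀ i, 0 ≤ p i) (hp : ∑ i, p i = 1)
    {Y : α → Matrix ι ι ℝ} (hY : ∀ i, (Y i).IsHermitian) (hmean : ∑ i, p i • Y i = 0)
    (hle : ∀ i (x : ι → ℝ), |x ⬝ᵥ Y i *ᵥ x| ≤ x ⬝ᵥ x) {v τ : ℝ} (hv0 : 0 < v)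
    (hv : (v • (1 : Matrix ι ι ℝ) - ∑ i, p i • Y i ^ 2).PosSemidef)
    (hτ : (∑ i, p i • Y i ^ 2).trace ≤ τ) (m : ℕ) :
    ∑ ω : Fin m → α, (∏ j, p (ω j)) * (exp (∑ j, Y (ω j)) - 1 - ∑ j, Y (ω j)).trace
      ≤ τ / v * ((1 + v) ^ m - 1) := by
  induction m with
  | zero => simp
  | succ m ih =>
    set W := ∑ i, p i • Y i ^ 2 with hW
    have hL := sum_prod_mul_linear_eq_zero hp hmean
      ((traceLinearMap ι ℝ ℝ) ∘ₗ (LinearMap.mulRight ℝ W)) m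
    simp only [LinearMap.comp_apply, LinearMap.mulRight_apply, traceLinearMap_apply] at hL
    rw [sum_prod_mul_succ p Y (fun S => (exp S - 1 - S).trace) m]
    calc _ ≤ ∑ ω : Fin m → α, (∏ j, p (ω j)) *
          ((1 + v) * (exp (∑ j, Y (ω j)) - 1 - ∑ j, Y (ω j)).trace + τ
            + ((∑ j, Y (ω j)) * W).trace) := by
          refine Finset.sum_le_sum fun ω _ =>
            mul_le_mul_of_nonneg_left ?_ (Finset.prod_nonneg fun j _ => hp0 _)
          exact sum_mul_trace_exp_add_le hp0 hp hY hmean hle hv hτ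
            (isSelfAdjoint_sum _ fun j _ => hY _)
      _ = (1 + v) * (∑ ω : Fin m → α, (∏ j, p (ω j)) *
          (exp (∑ j, Y (ω j)) - 1 - ∑ j, Y (ω j)).trace) + τ := by
          simp only [mul_add, Finset.sum_add_distrib, hL, ← Finset.sum_mul, sum_prod_eq_one hp,
            Finset.mul_sum, mul_left_comm (1 + v)]
          ring
      _ ≤ (1 + v) * (τ / v * ((1 + v) ^ m - 1)) + τ := by gcongr
      _ = _ := by field_simp; ring

open NormedSpace in
/-- A Bernstein-type tail bound with intrinsic dimension for sums of independent centred random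
symmetric matrices of norm at most one. -/
theorem sum_prod_filter_le {p : α → ℝ} (hp0 : ∀ i, 0 ≤ p i) (hp : ∑ i, p i = 1)
    {Y : α → Matrix ι ι ℝ} (hY : ∀ i, (Y i).IsHermitian) (hmean : ∑ i, p i • Y i = 0)
    (hle : ∀ i (x : ι → ℝ), |x ⬝ᵥ Y i *ᵥ x| ≤ x ⬝ᵥ x) {v τ : ℝ} (hv0 : 0 < v)
    (hv : (v • (1 : Matrix ι ι ℝ) - ∑ i, p i • Y i ^ 2).PosSemidef)
    (hτ : (∑ i, p i • Y i ^ 2).trace ≤ τ) {m : ℕ} {t : ℝ} (ht : 0 ≤ t)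
    {s : Finset (Fin m → α)}
    (hs : ∀ ω ∈ s, ∃ x : ι → ℝ, x ⬝ᵥ x = 1 ∧ t ≤ x ⬝ᵥ (∑ j, Y (ω j)) *ᵥ x) :
    (∑ ω ∈ s, ∏ j, p (ω j)) * (Real.exp t - 1 - t) ≤ τ / v * ((1 + v) ^ m - 1) := by
  have hH : ∀ ω : Fin m → α, (∑ j, Y (ω j)).IsHermitian := fun ω =>
    isSelfAdjoint_sum _ fun j _ => hY _
  have hw : ∀ ω : Fin m → α, 0 ≤ ∏ j, p (ω j) := fun ω => Finset.prod_nonneg fun j _ => hp0 _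
  refine le_trans ?_ (sum_prod_mul_trace_exp_le hp0 hp hY hmean hle hv0 hv hτ m)
  rw [Finset.sum_mul]
  refine (Finset.sum_le_sum fun ω hω => ?_).trans (Finset.sum_le_univ_sum_of_nonneg fun ω =>
    mul_nonneg (hw ω) (hH ω).posSemidef_exp_sub_one_sub.trace_nonneg)
  obtain ⟨x, hx, hxt⟩ := hs ω hω
  exact mul_le_mul_of_nonneg_left ((hH ω).le_trace_exp_sub_one_sub ht hx hxt) (hw ω)

end Matrix

namespace Matrix

variable {κ l : Type*}

/-- The symmetric dilation of a rectangular matrix. -/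
def dilation (M : Matrix κ l ℝ) : Matrix (κ ⊕ l) (κ ⊕ l) ℝ := fromBlocks 0 M Mᵀ 0

theorem isHermitian_dilation (M : Matrix κ l ℝ) : M.dilation.IsHermitian := by
  simp [dilation, IsHermitian, conjTranspose_eq_transpose_of_trivial, fromBlocks_transpose]

theorem dilation_sub (M N : Matrix κ l ℝ) : (M - N).dilation = M.dilation - N.dilation := by
  simp [dilation, sub_eq_add_neg, fromBlocks_neg, fromBlocks_add]

theorem dilation_sum {α : Type*} (s : Finset α) (X : α → Matrix κ l ℝ) :
    (∑ i ∈ s, X i).dilation = ∑ i ∈ s, (X i).dilation := by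
  ext (i | i) (j | j) <;> simp [dilation, sum_apply]

theorem dilation_smul (c : ℝ) (M : Matrix κ l ℝ) : (c • M).dilation = c • M.dilation := by
  simp [dilation, fromBlocks_smul]

theorem dotProduct_self_nonneg_real {ι : Type*} [Fintype ι] (x : ι → ℝ) : 0 ≤ x ⬝ᵥ x :=
  Finset.sum_nonneg fun _ _ => mul_self_nonneg _

variable [Fintype κ] [Fintype l]

theorem dotProduct_dilation_mulVec (M : Matrix κ l ℝ) (x : κ ⊕ l → ℝ) :
    x ⬝ᵥ M.dilation *ᵥ x = 2 * ((x ∘ Sum.inl) ⬝ᵥ M *ᵥ (x ∘ Sum.inr)) := by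
  have h : (x ∘ Sum.inr) ⬝ᵥ Mᵀ *ᵥ (x ∘ Sum.inl) = (x ∘ Sum.inl) ⬝ᵥ M *ᵥ (x ∘ Sum.inr) := by
    rw [mulVec_transpose, dotProduct_comm, ← dotProduct_mulVec]
  rw [dilation, fromBlocks_mulVec, ← Sum.elim_comp_inl_inr x, sumElim_dotProduct_sumElim]
  simp only [Sum.elim_comp_inl, Sum.elim_comp_inr, zero_mulVec, zero_add, add_zero, h]
  ring

variable [DecidableEq κ] [DecidableEq l]

theorem dotProduct_dilation_sq_mulVec (M : Matrix κ l ℝ) (x : κ ⊕ l → ℝ) :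
    x ⬝ᵥ (M.dilation ^ 2) *ᵥ x = (M *ᵥ (x ∘ Sum.inr)) ⬝ᵥ (M *ᵥ (x ∘ Sum.inr))
      + (Mᵀ *ᵥ (x ∘ Sum.inl)) ⬝ᵥ (Mᵀ *ᵥ (x ∘ Sum.inl)) := by
  have h : x ⬝ᵥ (M.dilation ^ 2) *ᵥ x = (M.dilation *ᵥ x) ⬝ᵥ (M.dilation *ᵥ x) := by
    rw [sq, ← mulVec_mulVec, dotProduct_mulVec, ← mulVec_transpose]
    congr 2
    simpa using (isHermitian_dilation M).eq
  rw [h, dilation, fromBlocks_mulVec, sumElim_dotProduct_sumElim]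
  simp

theorem trace_dilation_sq (M : Matrix κ l ℝ) : (M.dilation ^ 2).trace = 2 * (M * Mᵀ).trace := by
  rw [sq, dilation, fromBlocks_multiply]
  have h : ∀ (P : Matrix κ κ ℝ) (Q : Matrix l l ℝ),
      (fromBlocks P 0 0 Q).trace = P.trace + Q.trace := fun P Q => by
    simp [Matrix.trace, Fintype.sum_sum_type]
  simp only [Matrix.zero_mul, Matrix.mul_zero, zero_add, add_zero]
  rw [h, trace_mul_comm Mᵀ M, two_mul]

/-- A Bernstein-type tail bound with intrinsic dimension for sums of independent rectangular
random matrices. -/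
theorem sum_prod_filter_rect_le {α : Type*} [Fintype α] {p : α → ℝ} (hp0 : ∀ i, 0 ≤ p i)
    (hp : ∑ i, p i = 1) {X : α → Matrix κ l ℝ} {C : Matrix κ l ℝ} (hC : ∑ i, p i • X i = C)
    {R V T θ σ : ℝ} (hV0 : 0 < V) (hθ : 0 < θ) (hθR : θ * R ≤ 1) (hσ : 0 ≤ σ)
    (hR : ∀ i u w, 2 * |u ⬝ᵥ (X i - C) *ᵥ w| ≤ R * (u ⬝ᵥ u + w ⬝ᵥ w))
    (hV1 : ∀ w, ∑ i, p i * ((X i *ᵥ w) ⬝ᵥ (X i *ᵥ w)) ≤ V * (w ⬝ᵥ w))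
    (hV2 : ∀ u, ∑ i, p i * (((X i)ᵀ *ᵥ u) ⬝ᵥ ((X i)ᵀ *ᵥ u)) ≤ V * (u ⬝ᵥ u))
    (hT : ∑ i, p i * (X i * (X i)ᵀ).trace ≤ T) {m : ℕ} {s : Finset (Fin m → α)}
    (hs : ∀ ω ∈ s, ∃ u w, u ⬝ᵥ u = 1 ∧ w ⬝ᵥ w = 1 ∧ σ ≤ u ⬝ᵥ (∑ j, (X (ω j) - C)) *ᵥ w) :
    (∑ ω ∈ s, ∏ j, p (ω j)) * (Real.exp (θ * σ) - 1 - θ * σ)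
      ≤ 2 * T / V * ((1 + θ ^ 2 * V) ^ m - 1) := by
  have hxx : ∀ x : κ ⊕ l → ℝ,
      x ⬝ᵥ x = (x ∘ Sum.inl) ⬝ᵥ (x ∘ Sum.inl) + (x ∘ Sum.inr) ⬝ᵥ (x ∘ Sum.inr) := fun x => by
    simp [dotProduct, Fintype.sum_sum_type]
  set Y : α → Matrix (κ ⊕ l) (κ ⊕ l) ℝ := fun i => θ • (X i - C).dilation with hYdef
  have hCd : ∑ i, p i • (X i).dilation = C.dilation := by
    rw [← hC, dilation_sum]; simp only [dilation_smul]
  have hmean : ∑ i, p i • Y i = 0 := by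
    simp only [hYdef, dilation_sub, smul_sub, smul_comm (p _) θ, Finset.sum_sub_distrib]
    rw [← Finset.smul_sum, ← Finset.smul_sum, hCd, ← Finset.sum_smul, hp, one_smul, sub_self]
  have hvar : ∑ i, p i • Y i ^ 2
      = θ ^ 2 • (∑ i, p i • (X i).dilation ^ 2 - C.dilation ^ 2) := by
    have h1 : ∀ i, p i • Y i ^ 2 = θ ^ 2 • (p i • (X i).dilation ^ 2
        - (p i • (X i).dilation) * C.dilation - C.dilation * (p i • (X i).dilation)
        + p i • C.dilation ^ 2) := fun i => by
      simp only [hYdef, dilation_sub, smul_pow, smul_comm (p i) (θ ^ 2)]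
      congr 1
      rw [smul_mul_assoc, mul_smul_comm, ← smul_sub, ← smul_sub, ← smul_add]
      congr 1
      simp only [sq]
      noncomm_ring
    simp only [h1]
    rw [← Finset.smul_sum, Finset.sum_add_distrib, Finset.sum_sub_distrib, Finset.sum_sub_distrib,
      ← Finset.sum_mul, ← Finset.mul_sum, hCd, ← Finset.sum_smul, hp, one_smul, ← sq]
    congr 1
    abel
  have hY : ∀ i, (Y i).IsHermitian := fun i => by
    rw [hYdef, IsHermitian, conjTranspose_smul, (isHermitian_dilation _).eq, star_trivial]
  have key := sum_prod_filter_le hp0 hp hY hmean (v := θ ^ 2 * V) (τ := θ ^ 2 * (2 * T))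
    (t := θ * σ) (m := m) (s := s) ?_ (by positivity) ?_ ?_ (by positivity) ?_
  · refine key.trans_eq ?_
    rw [mul_div_mul_left _ _ (by positivity)]
  · intro i x
    simp only [hYdef]
    rw [smul_mulVec, dotProduct_smul, dotProduct_dilation_mulVec, hxx, smul_eq_mul, abs_mul,
      abs_mul, abs_of_pos hθ, abs_of_pos (two_pos : (0 : ℝ) < 2)]
    calc _ ≤ θ * (R * _) := mul_le_mul_of_nonneg_left (hR i _ _) hθ.le
      _ = θ * R * _ := (mul_assoc _ _ _).symm
      _ ≤ 1 * _ := mul_le_mul_of_nonneg_right hθR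
          (add_nonneg (dotProduct_self_nonneg_real _) (dotProduct_self_nonneg_real _))
      _ = _ := one_mul _
  · refine PosSemidef.of_dotProduct_mulVec_nonneg ?_ fun x => ?_
    · refine IsHermitian.sub ?_ (isSelfAdjoint_sum _ fun i _ => ?_)
      · rw [IsHermitian, conjTranspose_smul, conjTranspose_one, star_trivial]
      · exact ((hY i).pow 2).smul (IsSelfAdjoint.all (p i))
    · have h1 : x ⬝ᵥ (∑ i, p i • (X i).dilation ^ 2) *ᵥ x
          = ∑ i, p i * ((X i *ᵥ (x ∘ Sum.inr)) ⬝ᵥ (X i *ᵥ (x ∘ Sum.inr)))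
            + ∑ i, p i * (((X i)ᵀ *ᵥ (x ∘ Sum.inl)) ⬝ᵥ ((X i)ᵀ *ᵥ (x ∘ Sum.inl))) := by
        rw [sum_mulVec, dotProduct_sum, ← Finset.sum_add_distrib]
        refine Finset.sum_congr rfl fun i _ => ?_
        rw [smul_mulVec, dotProduct_smul, dotProduct_dilation_sq_mulVec, smul_eq_mul, mul_add]
      have h2 : 0 ≤ x ⬝ᵥ (C.dilation ^ 2) *ᵥ x := by
        rw [dotProduct_dilation_sq_mulVec]; exact add_nonneg (dotProduct_self_nonneg_real _) (dotProduct_self_nonneg_real _)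
      rw [hvar, star_trivial, sub_mulVec, dotProduct_sub, smul_mulVec, one_mulVec, dotProduct_smul,
        smul_mulVec, dotProduct_smul, sub_mulVec, dotProduct_sub, h1, hxx, smul_eq_mul, smul_eq_mul,
        mul_assoc, ← mul_sub]
      refine mul_nonneg (sq_nonneg θ) ?_
      linarith [hV1 (x ∘ Sum.inr), hV2 (x ∘ Sum.inl)]
  · rw [hvar, trace_smul, trace_sub, trace_sum, trace_dilation_sq, smul_eq_mul]
    refine mul_le_mul_of_nonneg_left ?_ (sq_nonneg θ)
    have h1 : 0 ≤ (C * Cᵀ).trace := by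
      simpa [conjTranspose_eq_transpose_of_trivial] using
        (posSemidef_self_mul_conjTranspose C).trace_nonneg
    have h2 : ∑ i, (p i • (X i).dilation ^ 2).trace = 2 * ∑ i, p i * (X i * (X i)ᵀ).trace := by
      rw [Finset.mul_sum]
      refine Finset.sum_congr rfl fun i _ => ?_
      rw [trace_smul, trace_dilation_sq, smul_eq_mul]; ring
    rw [h2]
    linarith
  · intro ω hω
    obtain ⟨u, w, hu, hw, h⟩ := hs ω hω
    have h2 : (√2)⁻¹ * (√2)⁻¹ = (2 : ℝ)⁻¹ := by
      rw [← mul_inv, Real.mul_self_sqrt zero_le_two]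
    refine ⟨(√2)⁻¹ • Sum.elim u w, ?_, ?_⟩
    · rw [smul_dotProduct, dotProduct_smul, sumElim_dotProduct_sumElim, hu, hw, smul_smul, h2]
      norm_num
    · rw [mulVec_smul, smul_dotProduct, dotProduct_smul, smul_smul, h2]
      simp only [hYdef]
      rw [← Finset.smul_sum, ← dilation_sum, smul_mulVec, dotProduct_smul,
        dotProduct_dilation_mulVec]
      simp only [Sum.elim_comp_inl, Sum.elim_comp_inr, smul_eq_mul]
      calc θ * σ ≤ θ * _ := mul_le_mul_of_nonneg_left h hθ.le
        _ = _ := by ring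

end Matrix

theorem colNorm_sq {d : ℕ} (v : Fin d → ℝ) : colNorm v ^ 2 = v ⬝ᵥ v := by
  rw [colNorm, Real.sq_sqrt (Finset.sum_nonneg fun _ _ => sq_nonneg _)]
  simp [dotProduct, sq]

theorem frobNorm_sq {d n : ℕ} (M : Matrix (Fin d) (Fin n) ℝ) :
    frobNorm M ^ 2 = ∑ i, ∑ j, M i j ^ 2 := by
  exact Real.sq_sqrt (Finset.sum_nonneg fun _ _ => Finset.sum_nonneg fun _ _ => sq_nonneg _)

theorem frobNorm_sq_eq_sum_col {d n : ℕ} (M : Matrix (Fin d) (Fin n) ℝ) :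
    frobNorm M ^ 2 = ∑ j, (M · j) ⬝ᵥ (M · j) := by
  rw [frobNorm_sq, Finset.sum_comm]
  simp [dotProduct, sq]

theorem norm_toLp_sq {d : ℕ} (v : Fin d → ℝ) : ‖WithLp.toLp 2 v‖ ^ 2 = v ⬝ᵥ v := by
  rw [EuclideanSpace.real_norm_sq_eq]
  simp [dotProduct, sq]

theorem specNorm_nonneg {d n : ℕ} (M : Matrix (Fin d) (Fin n) ℝ) : 0 ≤ specNorm M :=
  norm_nonneg _

theorem specNorm_pos {d n : ℕ} {M : Matrix (Fin d) (Fin n) ℝ} (hM : M ≠ 0) : 0 < specNorm M := by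
  rw [specNorm, norm_pos_iff]
  intro h
  apply hM
  simpa using h

theorem mulVec_dotProduct_self_le {d n : ℕ} (M : Matrix (Fin d) (Fin n) ℝ) (w : Fin n → ℝ) :
    (M *ᵥ w) ⬝ᵥ (M *ᵥ w) ≤ specNorm M ^ 2 * (w ⬝ᵥ w) := by
  have h := (LinearMap.toContinuousLinearMap (Matrix.toEuclideanLin M)).le_opNorm (WithLp.toLp 2 w)
  rw [LinearMap.coe_toContinuousLinearMap', toLpLin_apply] at h
  rw [← norm_toLp_sq, ← norm_toLp_sq, ← mul_pow]
  exact pow_le_pow_left₀ (norm_nonneg _) h 2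

theorem dotProduct_sq_le {ι : Type*} [Fintype ι] (x y : ι → ℝ) :
    (x ⬝ᵥ y) ^ 2 ≤ (x ⬝ᵥ x) * (y ⬝ᵥ y) := by
  simpa [dotProduct, sq] using Finset.sum_mul_sq_le_sq_mul_sq Finset.univ x y

theorem transpose_mulVec_dotProduct_self_le {d n : ℕ} (M : Matrix (Fin d) (Fin n) ℝ)
    (u : Fin d → ℝ) : (Mᵀ *ᵥ u) ⬝ᵥ (Mᵀ *ᵥ u) ≤ specNorm M ^ 2 * (u ⬝ᵥ u) := by
  set q := (Mᵀ *ᵥ u) ⬝ᵥ (Mᵀ *ᵥ u) with hq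
  have hq0 : 0 ≤ q := dotProduct_self_nonneg_real _
  have h1 : q = u ⬝ᵥ (M *ᵥ (Mᵀ *ᵥ u)) := by
    rw [hq, dotProduct_mulVec u, ← mulVec_transpose]
  have h2 : q ^ 2 ≤ (u ⬝ᵥ u) * (specNorm M ^ 2 * q) := by
    rw [h1]
    refine (dotProduct_sq_le _ _).trans ?_
    rw [← h1]
    exact mul_le_mul_of_nonneg_left (mulVec_dotProduct_self_le M _) (dotProduct_self_nonneg_real u)
  rcases hq0.eq_or_lt with h | h
  · rw [← h]; exact mul_nonneg (sq_nonneg _) (dotProduct_self_nonneg_real _)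
  · nlinarith

theorem exists_lt_dotProduct_mulVec {d n : ℕ} {M : Matrix (Fin d) (Fin n) ℝ} {σ : ℝ}
    (hσ : 0 ≤ σ) (h : σ < specNorm M) : ∃ u w, u ⬝ᵥ u = 1 ∧ w ⬝ᵥ w = 1 ∧ σ ≤ u ⬝ᵥ M *ᵥ w := by
  have h1 : ∃ x, σ * ‖x‖ < ‖LinearMap.toContinuousLinearMap (Matrix.toEuclideanLin M) x‖ := by
    by_contra! hcon
    exact absurd (ContinuousLinearMap.opNorm_le_bound _ hσ hcon) (not_le.2 h)
  obtain ⟨x, hx⟩ := h1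
  rw [LinearMap.coe_toContinuousLinearMap', toLpLin_apply] at hx
  obtain ⟨w, rfl⟩ : ∃ w, x = WithLp.toLp 2 w := ⟨x.ofLp, rfl⟩
  set y := M *ᵥ w with hy
  set a := ‖WithLp.toLp 2 w‖ with ha
  set b := ‖WithLp.toLp 2 y‖ with hb
  change σ * a < b at hx
  have ha0 : 0 ≤ a := norm_nonneg _
  have hb0 : 0 < b := lt_of_le_of_lt (mul_nonneg hσ ha0) hx
  have ha1 : a ≠ 0 := by
    intro h0
    have hw : w = 0 := by simpa [ha] using h0
    apply hb0.ne'
    rw [hb, hy, hw]; simp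
  have hap : 0 < a := lt_of_le_of_ne ha0 ha1.symm
  have haa : w ⬝ᵥ w = a ^ 2 := (norm_toLp_sq w).symm
  have hbb : y ⬝ᵥ y = b ^ 2 := (norm_toLp_sq y).symm
  refine ⟨b⁻¹ • y, a⁻¹ • w, ?_, ?_, ?_⟩
  · rw [smul_dotProduct, dotProduct_smul, hbb]; simp only [smul_eq_mul]; field_simp
  · rw [smul_dotProduct, dotProduct_smul, haa]; simp only [smul_eq_mul]; field_simp
  · rw [mulVec_smul, smul_dotProduct, dotProduct_smul, ← hy, hbb]
    simp only [smul_eq_mul]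
    rw [show b⁻¹ * (a⁻¹ * b ^ 2) = b / a by field_simp, le_div_iff₀ hap]
    exact hx.le

theorem specNorm_le_frobNorm {d n : ℕ} (M : Matrix (Fin d) (Fin n) ℝ) :
    specNorm M ≤ frobNorm M := by
  by_contra! hlt
  have hF : 0 ≤ frobNorm M := Real.sqrt_nonneg _
  obtain ⟨σ, h1, h2⟩ := exists_between hlt
  obtain ⟨u, w, hu, hw, h⟩ := exists_lt_dotProduct_mulVec (hF.trans h1.le) h2
  have h3 := dotProduct_sq_le u (M *ᵥ w)
  have h4 : (M *ᵥ w) ⬝ᵥ (M *ᵥ w) ≤ frobNorm M ^ 2 := by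
    rw [frobNorm_sq, dotProduct]
    refine Finset.sum_le_sum fun i _ => ?_
    have h5 := dotProduct_sq_le (M i) w
    rw [hw, mul_one] at h5
    rw [← sq]
    refine h5.trans_eq ?_
    simp [dotProduct, sq]
  rw [hu, one_mul] at h3
  have h6 : σ ^ 2 ≤ (u ⬝ᵥ M *ᵥ w) ^ 2 := pow_le_pow_left₀ (hF.trans h1.le) h 2
  have h7 : frobNorm M ^ 2 < σ ^ 2 := pow_lt_pow_left₀ h1 hF two_ne_zero
  linarith

theorem one_le_srank {d n : ℕ} {M : Matrix (Fin d) (Fin n) ℝ} (hM : M ≠ 0) : 1 ≤ srank M := by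
  rw [srank, one_le_div (pow_pos (specNorm_pos hM) 2)]
  exact pow_le_pow_left₀ (specNorm_nonneg M) (specNorm_le_frobNorm M) 2

theorem smul_vecMulVec_mulVec_dotProduct_self {κ l : Type*} [Fintype κ] [Fintype l] (c : ℝ)
    (a : κ → ℝ) (b w : l → ℝ) :
    ((c • vecMulVec a b) *ᵥ w) ⬝ᵥ ((c • vecMulVec a b) *ᵥ w)
      = c ^ 2 * (b ⬝ᵥ w) ^ 2 * (a ⬝ᵥ a) := by
  rw [smul_mulVec, vecMulVec_mulVec, op_smul_eq_smul, smul_dotProduct, dotProduct_smul,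
    smul_dotProduct, dotProduct_smul]
  simp only [smul_eq_mul]
  ring

theorem trace_smul_vecMulVec_mul_transpose {κ l : Type*} [Fintype κ] [Fintype l] (c : ℝ)
    (a : κ → ℝ) (b : l → ℝ) :
    ((c • vecMulVec a b) * (c • vecMulVec a b)ᵀ).trace = c ^ 2 * (a ⬝ᵥ a) * (b ⬝ᵥ b) := by
  rw [transpose_smul, transpose_vecMulVec, Matrix.smul_mul, Matrix.mul_smul,
    vecMulVec_mul_vecMulVec, trace_smul, trace_smul, trace_vecMulVec,
    dotProduct_smul]
  simp only [smul_eq_mul]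
  ring

theorem two_mul_abs_le_of_sq_le {q c x y : ℝ} (hc : 0 ≤ c) (hx : 0 ≤ x) (hy : 0 ≤ y)
    (h : q ^ 2 ≤ c ^ 2 * (x * y)) : 2 * |q| ≤ c * (x + y) := by
  have h1 : |2 * q| ≤ c * (x + y) := by
    refine abs_le_of_sq_le_sq ?_ (mul_nonneg hc (add_nonneg hx hy))
    nlinarith [mul_nonneg (sq_nonneg c) (sq_nonneg (x - y))]
  rwa [abs_mul, abs_two] at h1

/-- Probability of an event for an i.i.d. sample from a finitely supported distribution. -/
theorem pi_sum_dirac_apply {n m : ℕ} {p : Fin n → ℝ} (hp0 : ∀ i, 0 ≤ p i)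
    (s : Finset (Fin m → Fin n)) :
    (Measure.pi fun _ : Fin m => ∑ i : Fin n, ENNReal.ofReal (p i) • Measure.dirac i) s
      = ENNReal.ofReal (∑ ω ∈ s, ∏ j, p (ω j)) := by
  have hfin : IsFiniteMeasure (∑ i : Fin n, ENNReal.ofReal (p i) • Measure.dirac i) := by
    constructor
    simp [Measure.finsetSum_apply, ENNReal.sum_lt_top]
  rw [← sum_measure_singleton,
    ENNReal.ofReal_sum_of_nonneg fun ω _ => Finset.prod_nonneg fun j _ => hp0 _]
  refine Finset.sum_congr rfl fun ω _ => ?_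
  rw [Measure.pi_singleton, ENNReal.ofReal_prod_of_nonneg fun j _ => hp0 _]
  refine Finset.prod_congr rfl fun j _ => ?_
  rw [Measure.finsetSum_apply]
  simp [Set.indicator_apply]

/-- Turning the exponential-moment bound into a probability of at most one quarter. -/
theorem le_one_quarter_of_mul_exp_le {P r t : ℝ} (hP : 0 ≤ P) (hr : 1 ≤ r)
    (ht : 10 * Real.log (2 + r) ≤ t)
    (h : P * (Real.exp t - 1 - t) ≤ 2 * r * Real.exp (t / 2)) : P ≤ 1 / 4 := by
  have h1 : 1 ≤ Real.log (2 + r) := by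
    rw [Real.le_log_iff_exp_le (by linarith)]
    linarith [Real.exp_one_lt_d9]
  have ht10 : 10 ≤ t := by linarith
  have h2 := Real.quadratic_le_exp_of_nonneg (by linarith : 0 ≤ t)
  have h3 : Real.exp t / 2 ≤ Real.exp t - 1 - t := by nlinarith
  have h4 : (2 + r) ^ 5 ≤ Real.exp (t / 2) := by
    rw [← Real.exp_log (by linarith : 0 < 2 + r), ← Real.exp_nat_mul]
    apply Real.exp_le_exp.2
    push_cast
    linarith
  have h5 : Real.exp t = Real.exp (t / 2) * Real.exp (t / 2) := by
    rw [← Real.exp_add]; ring_nf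
  have hE : 0 < Real.exp (t / 2) := Real.exp_pos _
  have h6 : 16 * r ≤ (2 + r) ^ 5 := by
    have h7 : (3 : ℝ) ^ 4 ≤ (2 + r) ^ 4 := pow_le_pow_left₀ (by norm_num) (by linarith) 4
    nlinarith
  have h8 : P * (Real.exp t / 2) ≤ 2 * r * Real.exp (t / 2) :=
    (mul_le_mul_of_nonneg_left h3 hP).trans h
  have h9 : P * Real.exp (t / 2) ≤ 4 * r := by
    rw [h5] at h8
    nlinarith
  have h10 : P * (16 * r) ≤ 4 * r := (mul_le_mul_of_nonneg_left (h6.trans h4) hP).trans h9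
  nlinarith

/-- The rectangular Bernstein bound at the chosen parameters gives probability at most one
quarter. -/
theorem le_one_quarter_of_tail_bound {P K M G r ε : ℝ} {m : ℕ} (hP : 0 ≤ P) (hK : 0 < K)
    (hM : 0 < M) (hG : 0 ≤ G) (hr : 1 ≤ r) (hε : 0 < ε)
    (hm : 40 * (M / ε ^ 2 + G / ε) * Real.log (2 + r) ≤ m)
    (h : P * (Real.exp (ε / (K * (4 * M + 2 * ε * G)) * (m * (ε * K))) - 1
          - ε / (K * (4 * M + 2 * ε * G)) * (m * (ε * K)))
        ≤ 2 * r * ((1 + (ε / (K * (4 * M + 2 * ε * G))) ^ 2 * (2 * K ^ 2 * M)) ^ m - 1)) :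
    P ≤ 1 / 4 := by
  have hεG : 0 ≤ ε * G := mul_nonneg hε.le hG
  set D := 4 * M + 2 * ε * G with hD
  have hD0 : 0 < D := by rw [hD]; nlinarith
  have e1 : ε / (K * D) * (m * (ε * K)) = m * ε ^ 2 / D := by field_simp
  have e2 : (ε / (K * D)) ^ 2 * (2 * K ^ 2 * M) = 2 * M * ε ^ 2 / D ^ 2 := by field_simp
  rw [e1, e2] at h
  have hL : 0 < Real.log (2 + r) := Real.log_pos (by linarith)
  refine le_one_quarter_of_mul_exp_le hP hr (t := m * ε ^ 2 / D) ?_ (h.trans ?_)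
  · rw [le_div_iff₀ hD0]
    have h1 : 40 * (M + G * ε) * Real.log (2 + r) ≤ m * ε ^ 2 := by
      calc 40 * (M + G * ε) * Real.log (2 + r)
          = 40 * (M / ε ^ 2 + G / ε) * Real.log (2 + r) * ε ^ 2 := by field_simp
        _ ≤ m * ε ^ 2 := mul_le_mul_of_nonneg_right hm (sq_nonneg ε)
    refine le_trans ?_ h1
    rw [hD]
    nlinarith [mul_nonneg hεG hL.le]
  · refine mul_le_mul_of_nonneg_left ?_ (by linarith)
    have h2 : (1 + 2 * M * ε ^ 2 / D ^ 2) ^ m ≤ Real.exp (m * ε ^ 2 / D / 2) := by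
      calc (1 + 2 * M * ε ^ 2 / D ^ 2) ^ m
          ≤ Real.exp (2 * M * ε ^ 2 / D ^ 2) ^ m := by
            refine pow_le_pow_left₀ (by positivity) ?_ m
            rw [add_comm]
            exact Real.add_one_le_exp _
        _ = Real.exp (m * (2 * M * ε ^ 2 / D ^ 2)) := by rw [Real.exp_nat_mul]
        _ ≤ _ := by
            apply Real.exp_le_exp.2
            have h3 : 2 * M * ε ^ 2 / D ^ 2 ≤ ε ^ 2 / D / 2 := by
              rw [div_div, div_le_div_iff₀ (by positivity) (by positivity)]
              have h4 : 4 * M ≤ D := by rw [hD]; linarith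
              have h5 : 0 ≤ ε ^ 2 * D := by positivity
              nlinarith
            calc (m : ℝ) * (2 * M * ε ^ 2 / D ^ 2) ≤ m * (ε ^ 2 / D / 2) :=
                  mul_le_mul_of_nonneg_left h3 (Nat.cast_nonneg m)
              _ = _ := by ring
    linarith

section Sampling

variable {d₁ d₂ n : ℕ} {A : Matrix (Fin d₁) (Fin n) ℝ} {B : Matrix (Fin d₂) (Fin n) ℝ}
  {p : Fin n → ℝ}

theorem frobNorm_pos {d n : ℕ} {M : Matrix (Fin d) (Fin n) ℝ} (hM : M ≠ 0) : 0 < frobNorm M :=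
  (specNorm_pos hM).trans_le (specNorm_le_frobNorm M)

theorem sampling_sum_eq_one (hA : A ≠ 0) (hB : B ≠ 0)
    (hp : ∀ i, p i =
      (colNorm (A · i) ^ 2 / frobNorm A ^ 2 + colNorm (B · i) ^ 2 / frobNorm B ^ 2) / 2) :
    ∑ i, p i = 1 := by
  have hA' := (frobNorm_pos hA).ne'
  have hB' := (frobNorm_pos hB).ne'
  simp_rw [hp, colNorm_sq]
  rw [← Finset.sum_div, Finset.sum_add_distrib, ← Finset.sum_div, ← Finset.sum_div,
    ← frobNorm_sq_eq_sum_col, ← frobNorm_sq_eq_sum_col]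
  field_simp
  norm_num

theorem sampling_col_le_left (hA : A ≠ 0)
    (hp : ∀ i, p i =
      (colNorm (A · i) ^ 2 / frobNorm A ^ 2 + colNorm (B · i) ^ 2 / frobNorm B ^ 2) / 2)
    (i : Fin n) : (A · i) ⬝ᵥ (A · i) ≤ 2 * p i * frobNorm A ^ 2 := by
  have hA' := pow_pos (frobNorm_pos hA) 2
  have h : 0 ≤ colNorm (B · i) ^ 2 / frobNorm B ^ 2 := by positivity
  rw [← div_le_iff₀ hA', hp, ← colNorm_sq]
  linarith

theorem sampling_col_le_right (hB : B ≠ 0)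
    (hp : ∀ i, p i =
      (colNorm (A · i) ^ 2 / frobNorm A ^ 2 + colNorm (B · i) ^ 2 / frobNorm B ^ 2) / 2)
    (i : Fin n) : (B · i) ⬝ᵥ (B · i) ≤ 2 * p i * frobNorm B ^ 2 :=
  sampling_col_le_left (p := p) (B := A) hB (fun i => by rw [hp i, add_comm]) i

theorem sampling_col_mul_col_le (hA : A ≠ 0) (hB : B ≠ 0)
    (hp : ∀ i, p i =
      (colNorm (A · i) ^ 2 / frobNorm A ^ 2 + colNorm (B · i) ^ 2 / frobNorm B ^ 2) / 2)
    (i : Fin n) :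
    ((A · i) ⬝ᵥ (A · i)) * ((B · i) ⬝ᵥ (B · i)) ≤ p i ^ 2 * (frobNorm A * frobNorm B) ^ 2 := by
  have hA' := (frobNorm_pos hA).ne'
  have hB' := (frobNorm_pos hB).ne'
  rw [hp, ← colNorm_sq, ← colNorm_sq]
  set x := colNorm (A · i) ^ 2 / frobNorm A ^ 2 with hx
  set y := colNorm (B · i) ^ 2 / frobNorm B ^ 2 with hy
  have h1 : colNorm (A · i) ^ 2 = x * frobNorm A ^ 2 := by rw [hx]; field_simp
  have h2 : colNorm (B · i) ^ 2 = y * frobNorm B ^ 2 := by rw [hy]; field_simp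
  rw [h1, h2]
  nlinarith [mul_nonneg (sq_nonneg (x - y)) (sq_nonneg (frobNorm A * frobNorm B))]

theorem sampling_pos (hA : A ≠ 0) (hB : B ≠ 0)
    (hAB : ∀ i : Fin n, (fun k => A k i) ≠ 0 ∨ (fun k => B k i) ≠ 0)
    (hp : ∀ i, p i =
      (colNorm (A · i) ^ 2 / frobNorm A ^ 2 + colNorm (B · i) ^ 2 / frobNorm B ^ 2) / 2)
    (i : Fin n) : 0 < p i := by
  have hA' := pow_pos (frobNorm_pos hA) 2
  have hB' := pow_pos (frobNorm_pos hB) 2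
  have key : ∀ {d : ℕ} {v : Fin d → ℝ} {F : ℝ}, v ≠ 0 → v ⬝ᵥ v ≤ 2 * p i * F → 0 < F →
      0 < p i := by
    intro d v F hv h hF
    have h1 : 0 < v ⬝ᵥ v :=
      (dotProduct_self_nonneg_real v).lt_of_ne fun h0 => hv (dotProduct_self_eq_zero.1 h0.symm)
    by_contra! hn
    nlinarith
  rcases hAB i with h | h
  · exact key h (sampling_col_le_left hA hp i) hA'
  · exact key h (sampling_col_le_right hB hp i) hB'

theorem sum_col_dotProduct_sq {d n : ℕ} (M : Matrix (Fin d) (Fin n) ℝ) (u : Fin d → ℝ) :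
    ∑ i, ((M · i) ⬝ᵥ u) ^ 2 = (Mᵀ *ᵥ u) ⬝ᵥ (Mᵀ *ᵥ u) := by
  simp only [dotProduct, mulVec, transpose_apply, sq]

theorem sampling_sum_smul (hp0 : ∀ i, 0 < p i) :
    ∑ i, p i • ((1 / p i) • vecMulVec (A · i) (B · i)) = A * Bᵀ := by
  ext k l
  rw [Matrix.sum_apply, Matrix.mul_apply]
  refine Finset.sum_congr rfl fun i _ => ?_
  rw [smul_smul, mul_one_div_cancel (hp0 i).ne', one_smul, vecMulVec_apply, transpose_apply]

theorem sampling_second_moment_le {V : ℝ} (hB : ∀ i, 0 < p i)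
    (hA : ∀ i, (A · i) ⬝ᵥ (A · i) ≤ 2 * p i * frobNorm A ^ 2)
    (hV : 2 * frobNorm A ^ 2 * specNorm B ^ 2 ≤ V) (w : Fin d₂ → ℝ) :
    ∑ i, p i * ((((1 / p i) • vecMulVec (A · i) (B · i)) *ᵥ w) ⬝ᵥ
      (((1 / p i) • vecMulVec (A · i) (B · i)) *ᵥ w)) ≤ V * (w ⬝ᵥ w) := by
  calc _ ≤ ∑ i, 2 * frobNorm A ^ 2 * ((B · i) ⬝ᵥ w) ^ 2 := by
        refine Finset.sum_le_sum fun i _ => ?_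
        rw [smul_vecMulVec_mulVec_dotProduct_self]
        have hp := hB i
        calc p i * ((1 / p i) ^ 2 * ((B · i) ⬝ᵥ w) ^ 2 * ((A · i) ⬝ᵥ (A · i)))
            ≤ p i * ((1 / p i) ^ 2 * ((B · i) ⬝ᵥ w) ^ 2 * (2 * p i * frobNorm A ^ 2)) := by
              gcongr
              exact hA i
          _ = _ := by field_simp
    _ = 2 * frobNorm A ^ 2 * ((Bᵀ *ᵥ w) ⬝ᵥ (Bᵀ *ᵥ w)) := by
        rw [← Finset.mul_sum, sum_col_dotProduct_sq]
    _ ≤ 2 * frobNorm A ^ 2 * (specNorm B ^ 2 * (w ⬝ᵥ w)) :=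
        mul_le_mul_of_nonneg_left (transpose_mulVec_dotProduct_self_le B w) (by positivity)
    _ = 2 * frobNorm A ^ 2 * specNorm B ^ 2 * (w ⬝ᵥ w) := by ring
    _ ≤ _ := mul_le_mul_of_nonneg_right hV (dotProduct_self_nonneg_real w)

theorem sampling_trace_le (hp0 : ∀ i, 0 < p i)
    (hA : ∀ i, (A · i) ⬝ᵥ (A · i) ≤ 2 * p i * frobNorm A ^ 2) :
    ∑ i, p i * (((1 / p i) • vecMulVec (A · i) (B · i)) *
      ((1 / p i) • vecMulVec (A · i) (B · i))ᵀ).trace ≤ 2 * frobNorm A ^ 2 * frobNorm B ^ 2 := by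
  rw [frobNorm_sq_eq_sum_col B, Finset.mul_sum]
  refine Finset.sum_le_sum fun i _ => ?_
  rw [trace_smul_vecMulVec_mul_transpose]
  have hp := hp0 i
  have hb := dotProduct_self_nonneg_real (B · i)
  calc p i * ((1 / p i) ^ 2 * ((A · i) ⬝ᵥ (A · i)) * ((B · i) ⬝ᵥ (B · i)))
      ≤ p i * ((1 / p i) ^ 2 * (2 * p i * frobNorm A ^ 2) * ((B · i) ⬝ᵥ (B · i))) := by
        gcongr
        exact hA i
    _ = _ := by field_simp

theorem sampling_deviation_le (hp0 : ∀ i, 0 < p i) {F : ℝ} (hF : 0 ≤ F)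
    (hFn : ∀ i, ((A · i) ⬝ᵥ (A · i)) * ((B · i) ⬝ᵥ (B · i)) ≤ p i ^ 2 * F ^ 2)
    (hS : specNorm A * specNorm B ≤ F) (i : Fin n) (u : Fin d₁ → ℝ) (w : Fin d₂ → ℝ) :
    2 * |u ⬝ᵥ ((1 / p i) • vecMulVec (A · i) (B · i) - A * Bᵀ) *ᵥ w|
      ≤ 2 * F * (u ⬝ᵥ u + w ⬝ᵥ w) := by
  have hu := dotProduct_self_nonneg_real u
  have hw := dotProduct_self_nonneg_real w
  have hp := hp0 i
  have h1 : u ⬝ᵥ ((1 / p i) • vecMulVec (A · i) (B · i) - A * Bᵀ) *ᵥ w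
      = (1 / p i) * (((A · i) ⬝ᵥ u) * ((B · i) ⬝ᵥ w)) - (Aᵀ *ᵥ u) ⬝ᵥ (Bᵀ *ᵥ w) := by
    rw [sub_mulVec, dotProduct_sub, smul_mulVec, vecMulVec_mulVec, op_smul_eq_smul,
      dotProduct_smul, dotProduct_smul, ← mulVec_mulVec, dotProduct_mulVec u A,
      ← mulVec_transpose, dotProduct_comm u]
    simp only [smul_eq_mul]
    ring
  have h2 : 2 * |(1 / p i) * (((A · i) ⬝ᵥ u) * ((B · i) ⬝ᵥ w))| ≤ F * (u ⬝ᵥ u + w ⬝ᵥ w) := by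
    refine two_mul_abs_le_of_sq_le hF hu hw ?_
    have h3 := dotProduct_sq_le (A · i) u
    have h4 := dotProduct_sq_le (B · i) w
    calc ((1 / p i) * (((A · i) ⬝ᵥ u) * ((B · i) ⬝ᵥ w))) ^ 2
        = (1 / p i) ^ 2 * (((A · i) ⬝ᵥ u) ^ 2 * ((B · i) ⬝ᵥ w) ^ 2) := by ring
      _ ≤ (1 / p i) ^ 2 * ((((A · i) ⬝ᵥ (A · i)) * (u ⬝ᵥ u)) *
            (((B · i) ⬝ᵥ (B · i)) * (w ⬝ᵥ w))) :=
          mul_le_mul_of_nonneg_left (mul_le_mul h3 h4 (sq_nonneg _)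
            (mul_nonneg (dotProduct_self_nonneg_real _) hu)) (sq_nonneg _)
      _ = (1 / p i) ^ 2 * (((A · i) ⬝ᵥ (A · i)) * ((B · i) ⬝ᵥ (B · i))) *
            ((u ⬝ᵥ u) * (w ⬝ᵥ w)) := by ring
      _ ≤ (1 / p i) ^ 2 * (p i ^ 2 * F ^ 2) * ((u ⬝ᵥ u) * (w ⬝ᵥ w)) :=
          mul_le_mul_of_nonneg_right (mul_le_mul_of_nonneg_left (hFn i) (sq_nonneg _))
            (mul_nonneg hu hw)
      _ = F ^ 2 * ((u ⬝ᵥ u) * (w ⬝ᵥ w)) := by field_simp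
  have h5 : 2 * |(Aᵀ *ᵥ u) ⬝ᵥ (Bᵀ *ᵥ w)| ≤ F * (u ⬝ᵥ u + w ⬝ᵥ w) := by
    refine two_mul_abs_le_of_sq_le hF hu hw ((dotProduct_sq_le _ _).trans ?_)
    have hK : 0 ≤ specNorm A * specNorm B := mul_nonneg (specNorm_nonneg A) (specNorm_nonneg B)
    calc _ ≤ (specNorm A ^ 2 * (u ⬝ᵥ u)) * (specNorm B ^ 2 * (w ⬝ᵥ w)) :=
          mul_le_mul (transpose_mulVec_dotProduct_self_le A u)
            (transpose_mulVec_dotProduct_self_le B w) (dotProduct_self_nonneg_real _)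
            (mul_nonneg (sq_nonneg _) hu)
      _ = (specNorm A * specNorm B) ^ 2 * ((u ⬝ᵥ u) * (w ⬝ᵥ w)) := by ring
      _ ≤ _ := mul_le_mul_of_nonneg_right (pow_le_pow_left₀ hK hS 2) (mul_nonneg hu hw)
  rw [h1]
  have h6 := abs_sub ((1 / p i) * (((A · i) ⬝ᵥ u) * ((B · i) ⬝ᵥ w))) ((Aᵀ *ᵥ u) ⬝ᵥ (Bᵀ *ᵥ w))
  linarith

end Sampling

/-- Remark after Theorem 1: there is a universal constant `c > 0` such that
`m ≳ (sr(A) ∨ sr(B))/ε² + √(sr(A)·sr(B))/ε) · log(2 + sr(A) ∧ sr(B))` samples suffice for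
spectral-norm error `ε‖A‖‖B‖` with probability at least `3/4`. -/
theorem stmt1 :
    ∃ c : ℝ, 0 < c ∧
      ∀ (d₁ d₂ n m : ℕ)
        (A : Matrix (Fin d₁) (Fin n) ℝ) (B : Matrix (Fin d₂) (Fin n) ℝ),
        A ≠ 0 → B ≠ 0 →
        (∀ i : Fin n, (fun k => A k i) ≠ 0 ∨ (fun k => B k i) ≠ 0) →
        ∀ (p : Fin n → ℝ),
        (∀ i : Fin n, p i =
          (colNorm (A · i) ^ 2 / frobNorm A ^ 2 + colNorm (B · i) ^ 2 / frobNorm B ^ 2) / 2) →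
        ∀ (X : Fin m → (Fin m → Fin n) → Matrix (Fin d₁) (Fin d₂) ℝ),
        (∀ j ω, X j ω = (1 / p (ω j)) • Matrix.vecMulVec (A · (ω j)) (B · (ω j))) →
        ∀ (μ : Measure (Fin n)),
        μ = (∑ i : Fin n, ENNReal.ofReal (p i) • Measure.dirac i) →
        ∀ ε : ℝ, 0 < ε → ε < 1 →
        (m : ℝ) ≥ c * (max (srank A) (srank B) / ε ^ 2
            + Real.sqrt (srank A * srank B) / ε) * Real.log (2 + min (srank A) (srank B)) →
        (Measure.pi fun _ : Fin m => μ)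
          {ω | specNorm ((m : ℝ)⁻¹ • ∑ j : Fin m, X j ω - A * Bᵀ)
                > ε * (specNorm A * specNorm B)}
          ≤ 1 / 4 := by
  refine ⟨40, by norm_num, ?_⟩
  intro d₁ d₂ n m A B hA hB hAB p hp X hX μ hμ ε hε _ hm
  classical
  have hp0 := sampling_pos hA hB hAB hp
  have hp1 := sampling_sum_eq_one hA hB hp
  have hsA := specNorm_pos hA
  have hsB := specNorm_pos hB
  have hfA := frobNorm_pos hA
  have hfB := frobNorm_pos hB
  have hα := one_le_srank hA
  have hβ := one_le_srank hB
  have eA : frobNorm A ^ 2 = srank A * specNorm A ^ 2 := by rw [srank]; field_simp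
  have eB : frobNorm B ^ 2 = srank B * specNorm B ^ 2 := by rw [srank]; field_simp
  set K := specNorm A * specNorm B with hK
  have hK0 : 0 < K := mul_pos hsA hsB
  set M := max (srank A) (srank B) with hM
  set r := min (srank A) (srank B) with hr
  have hr1 : 1 ≤ r := le_min hα hβ
  have hM0 : 0 < M := lt_of_lt_of_le one_pos (hα.trans (le_max_left _ _))
  have hMr : M * r = srank A * srank B := max_mul_min _ _
  set G := √(srank A * srank B) with hG
  have hG0 : 0 ≤ G := Real.sqrt_nonneg _
  have hF : frobNorm A * frobNorm B = K * G := by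
    rw [← Real.sqrt_sq (mul_pos hfA hfB).le, mul_pow, eA, eB,
      show srank A * specNorm A ^ 2 * (srank B * specNorm B ^ 2)
        = K ^ 2 * (srank A * srank B) by rw [hK]; ring,
      Real.sqrt_mul (sq_nonneg K), Real.sqrt_sq hK0.le]
  have hL : 0 < Real.log (2 + r) := Real.log_pos (by linarith)
  have hm0 : (0 : ℝ) < m := by
    refine lt_of_lt_of_le ?_ hm
    have : 0 < M / ε ^ 2 := by positivity
    have : 0 ≤ G / ε := by positivity
    positivity
  set D := 4 * M + 2 * ε * G with hD
  have hD0 : 0 < D := by positivity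
  set s : Finset (Fin m → Fin n) := Finset.univ.filter fun ω =>
    ε * K < specNorm ((m : ℝ)⁻¹ • ∑ j : Fin m, X j ω - A * Bᵀ) with hs
  have hset : {ω | specNorm ((m : ℝ)⁻¹ • ∑ j : Fin m, X j ω - A * Bᵀ) > ε * K}
      = (s : Set (Fin m → Fin n)) := by
    ext ω; simp [hs]
  have hdev : ∀ ω ∈ s, ∃ u w, u ⬝ᵥ u = 1 ∧ w ⬝ᵥ w = 1 ∧ m * (ε * K) ≤ u ⬝ᵥ
      (∑ j, ((1 / p (ω j)) • vecMulVec (A · (ω j)) (B · (ω j)) - A * Bᵀ)) *ᵥ w := by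
    intro ω hω
    obtain ⟨u, w, hu, hw, h⟩ := exists_lt_dotProduct_mulVec (by positivity)
      (Finset.mem_filter.1 hω).2
    refine ⟨u, w, hu, hw, ?_⟩
    have e : ∑ j, ((1 / p (ω j)) • vecMulVec (A · (ω j)) (B · (ω j)) - A * Bᵀ)
        = (m : ℝ) • ((m : ℝ)⁻¹ • ∑ j : Fin m, X j ω - A * Bᵀ) := by
      rw [smul_sub, smul_smul, mul_inv_cancel₀ hm0.ne', one_smul, Finset.sum_sub_distrib,
        Finset.sum_const, Finset.card_univ, Fintype.card_fin, Nat.cast_smul_eq_nsmul]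
      simp_rw [hX]
    rw [e, smul_mulVec, dotProduct_smul, smul_eq_mul]
    exact mul_le_mul_of_nonneg_left h hm0.le
  have hcA := sampling_col_le_left hA hp
  have hcB := sampling_col_le_right hB hp
  have hF0 : 0 ≤ frobNorm A * frobNorm B := (mul_pos hfA hfB).le
  have hV1 : 2 * frobNorm A ^ 2 * specNorm B ^ 2 ≤ 2 * K ^ 2 * M := by
    rw [eA, hK]
    calc _ = 2 * (specNorm A * specNorm B) ^ 2 * srank A := by ring
      _ ≤ _ := mul_le_mul_of_nonneg_left (le_max_left _ _) (by positivity)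
  have hV2 : 2 * frobNorm B ^ 2 * specNorm A ^ 2 ≤ 2 * K ^ 2 * M := by
    rw [eB, hK]
    calc _ = 2 * (specNorm A * specNorm B) ^ 2 * srank B := by ring
      _ ≤ _ := mul_le_mul_of_nonneg_left (le_max_right _ _) (by positivity)
  have hmain := Matrix.sum_prod_filter_rect_le (θ := ε / (K * D)) (V := 2 * K ^ 2 * M)
    (fun i => (hp0 i).le) hp1 (sampling_sum_smul hp0) (by positivity) (by positivity)
    (by
      rw [hF, div_mul_eq_mul_div, div_le_one (by positivity), hD]
      nlinarith [mul_pos hK0 hM0])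
    (by positivity)
    (sampling_deviation_le hp0 hF0 (sampling_col_mul_col_le hA hB hp)
      (mul_le_mul (specNorm_le_frobNorm A) (specNorm_le_frobNorm B) hsB.le hfA.le))
    (sampling_second_moment_le hp0 hcA hV1)
    (fun u => by
      simpa only [transpose_smul, transpose_vecMulVec] using
        sampling_second_moment_le hp0 hcB hV2 u)
    (sampling_trace_le hp0 hcA) hdev
  have hTV : 2 * (2 * frobNorm A ^ 2 * frobNorm B ^ 2) / (2 * K ^ 2 * M) = 2 * r := by
    rw [div_eq_iff (by positivity), eA, eB,
      show 2 * r * (2 * K ^ 2 * M) = 4 * K ^ 2 * (M * r) by ring, hMr, hK]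
    ring
  rw [hTV] at hmain
  have hP : ∑ ω ∈ s, ∏ j, p (ω j) ≤ 1 / 4 :=
    le_one_quarter_of_tail_bound
      (Finset.sum_nonneg fun ω _ => Finset.prod_nonneg fun j _ => (hp0 _).le)
      hK0 hM0 hG0 hr1 hε hm hmain
  rw [hset, hμ, pi_sum_dirac_apply fun i => (hp0 i).le]
  calc ENNReal.ofReal (∑ ω ∈ s, ∏ j, p (ω j)) ≤ ENNReal.ofReal (1 / 4) :=
        ENNReal.ofReal_le_ofReal hP
    _ = 1 / 4 := by
        rw [ENNReal.ofReal_div_of_pos (by norm_num)]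
        norm_num
end

section
/- Let A ∈ ℝ^{d₁×n} and B ∈ ℝ^{d₂×n} be nonzero matrices with columns a₁,…,aₙ and b₁,…,bₙ, such that for every i ∈ [n] at least one of aᵢ, bᵢ is nonzero, and define pᵢ = (‖aᵢ‖²/‖A‖_F² + ‖bᵢ‖²/‖B‖_F²)/2. Then 2·∑_{i=1}^n (1/pᵢ)·‖aᵢ‖²·‖bᵢ‖² − 2·tr(ABᵀBAᵀ) ≤ 4·sr(A)·sr(B)·‖A‖²·‖B‖². -/
open Matrix MeasureTheory

theorem specNorm_ne_zero {d n : ℕ} {M : Matrix (Fin d) (Fin n) ℝ} (hM : M ≠ 0) :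
    specNorm M ≠ 0 := by
  rw [specNorm, norm_ne_zero_iff]
  simpa using hM

theorem sum_colNorm_sq {d n : ℕ} (M : Matrix (Fin d) (Fin n) ℝ) :
    ∑ i, colNorm (M · i) ^ 2 = frobNorm M ^ 2 := by
  rw [frobNorm, Real.sq_sqrt (by positivity), Finset.sum_comm]
  exact Finset.sum_congr rfl fun i _ => Real.sq_sqrt (by positivity)

theorem frobNorm_sq_pos {d n : ℕ} {M : Matrix (Fin d) (Fin n) ℝ} (hM : M ≠ 0) :
    0 < frobNorm M ^ 2 := by
  rw [frobNorm, Real.sq_sqrt (by positivity)]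
  obtain ⟨i, j, hij⟩ : ∃ i j, M i j ≠ 0 := by
    by_contra! h
    exact hM (Matrix.ext h)
  refine Finset.sum_pos' (fun i _ => by positivity) ⟨i, Finset.mem_univ i, ?_⟩
  exact Finset.sum_pos' (fun j _ => by positivity) ⟨j, Finset.mem_univ j, by positivity⟩

theorem trace_mul_transpose_mul_transpose_nonneg {d₁ d₂ n : ℕ}
    (A : Matrix (Fin d₁) (Fin n) ℝ) (B : Matrix (Fin d₂) (Fin n) ℝ) :
    0 ≤ Matrix.trace (A * Bᵀ * B * Aᵀ) := by
  have h : A * Bᵀ * B * Aᵀ = (B * Aᵀ)ᵀ * (B * Aᵀ) := by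
    simp [Matrix.transpose_mul, Matrix.mul_assoc]
  rw [h, Matrix.trace]
  refine Finset.sum_nonneg fun i _ => ?_
  rw [Matrix.diag_apply, Matrix.mul_apply]
  exact Finset.sum_nonneg fun j _ => mul_self_nonneg _

/-- The harmonic mean of the normalized weights `x / F` and `y / G` is at most their
arithmetic mean, scaled by `F * G`. -/
theorem one_div_mean_mul_mul_le {x y F G : ℝ} (hx : 0 ≤ x) (hy : 0 ≤ y) (hF : 0 < F)
    (hG : 0 < G) :
    1 / ((x / F + y / G) / 2) * x * y ≤ (x * G + y * F) / 2 := by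
  rcases (add_nonneg (mul_nonneg hx hG.le) (mul_nonneg hy hF.le)).eq_or_lt' with h | h
  · have h' : x / F + y / G = 0 := by
      rw [div_add_div _ _ hF.ne' hG.ne', mul_comm F y, h, zero_div]
    simp [h', h]
  · have h' : 1 / ((x / F + y / G) / 2) * x * y = 2 * (x * G) * (y * F) / (x * G + y * F) := by
      rw [div_add_div _ _ hF.ne' hG.ne', mul_comm F y]
      field_simp
    rw [h', div_le_iff₀ h]
    nlinarith [sq_nonneg (x * G - y * F)]

/-- Claim 3 (trace bound): `2·∑ᵢ (1/pᵢ)·‖aᵢ‖²‖bᵢ‖² − 2·tr(ABᵀBAᵀ) ≤ 4·sr(A)·sr(B)·‖A‖²‖B‖²`. -/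
theorem stmt8 {d₁ d₂ n : ℕ}
    (A : Matrix (Fin d₁) (Fin n) ℝ) (B : Matrix (Fin d₂) (Fin n) ℝ)
    (hA : A ≠ 0) (hB : B ≠ 0)
    (hcol : ∀ i : Fin n, (fun k => A k i) ≠ 0 ∨ (fun k => B k i) ≠ 0)
    (p : Fin n → ℝ)
    (hp : ∀ i : Fin n, p i =
      (colNorm (A · i) ^ 2 / frobNorm A ^ 2 + colNorm (B · i) ^ 2 / frobNorm B ^ 2) / 2) :
    2 * (∑ i : Fin n, (1 / p i) * colNorm (A · i) ^ 2 * colNorm (B · i) ^ 2)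
      - 2 * Matrix.trace (A * Bᵀ * B * Aᵀ)
      ≤ 4 * srank A * srank B * (specNorm A ^ 2 * specNorm B ^ 2) := by
  have hF := frobNorm_sq_pos hA
  have hG := frobNorm_sq_pos hB
  have hsA := specNorm_ne_zero hA
  have hsB := specNorm_ne_zero hB
  have hrhs : 4 * srank A * srank B * (specNorm A ^ 2 * specNorm B ^ 2)
      = 4 * (frobNorm A ^ 2 * frobNorm B ^ 2) := by
    rw [srank, srank]
    field_simp
  have hsum : ∑ i : Fin n, (1 / p i) * colNorm (A · i) ^ 2 * colNorm (B · i) ^ 2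
      ≤ frobNorm A ^ 2 * frobNorm B ^ 2 := by
    calc _ ≤ ∑ i : Fin n, (colNorm (A · i) ^ 2 * frobNorm B ^ 2
          + colNorm (B · i) ^ 2 * frobNorm A ^ 2) / 2 := by
          refine Finset.sum_le_sum fun i _ => ?_
          rw [hp i]
          exact one_div_mean_mul_mul_le (sq_nonneg _) (sq_nonneg _) hF hG
      _ = frobNorm A ^ 2 * frobNorm B ^ 2 := by
          rw [← Finset.sum_div, Finset.sum_add_distrib, ← Finset.sum_mul, ← Finset.sum_mul,
            sum_colNorm_sq, sum_colNorm_sq]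
          ring
  have htr := trace_mul_transpose_mul_transpose_nonneg A B
  rw [hrhs]
  nlinarith [mul_pos hF hG]
end

section
/- Let A ∈ ℝ^{d₁×n} and B ∈ ℝ^{d₂×n} be nonzero matrices with columns a₁,…,aₙ and b₁,…,bₙ, such that for every i ∈ [n] at least one of aᵢ, bᵢ is nonzero, and define pᵢ = (‖aᵢ‖²/‖A‖_F² + ‖bᵢ‖²/‖B‖_F²)/2. Then ∑_{i=1}^n (1/pᵢ)·‖aᵢ‖²·‖bᵢ‖² ≤ 2·‖A‖_F²·‖B‖_F². -/
open Matrix MeasureTheory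

theorem colNorm_sq_le_frobNorm_sq {d n : ℕ} (M : Matrix (Fin d) (Fin n) ℝ) (i : Fin n) :
    colNorm (M · i) ^ 2 ≤ frobNorm M ^ 2 := by
  rw [← sum_colNorm_sq]
  exact Finset.single_le_sum (f := fun i ↦ colNorm (M · i) ^ 2)
    (fun _ _ ↦ sq_nonneg _) (Finset.mem_univ i)

theorem one_div_mul_le_two_mul {a s y q : ℝ} (ha : 0 ≤ a) (has : a ≤ s) (hy : 0 ≤ y)
    (hq : q = (a / s + y) / 2) : 1 / q * a ≤ 2 * s := by
  rcases ha.eq_or_lt with rfl | ha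
  · simpa using has
  · have hs : 0 < s := ha.trans_le has
    have has' : 0 < a / s := div_pos ha hs
    have hq0 : 0 < q := by rw [hq]; positivity
    rw [one_div_mul_eq_div, div_le_iff₀ hq0, hq]
    have h : s * (a / s) = a := mul_div_cancel₀ a hs.ne'
    nlinarith [mul_nonneg hs.le hy]

/-- `∑ᵢ (1/pᵢ)·‖aᵢ‖²‖bᵢ‖² ≤ 2·‖A‖_F²‖B‖_F²` for the mixed column-norm sampling
probabilities. -/
theorem stmt9 {d₁ d₂ n : ℕ}
    (A : Matrix (Fin d₁) (Fin n) ℝ) (B : Matrix (Fin d₂) (Fin n) ℝ)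
    (hA : A ≠ 0) (hB : B ≠ 0)
    (hcol : ∀ i : Fin n, (fun k => A k i) ≠ 0 ∨ (fun k => B k i) ≠ 0)
    (p : Fin n → ℝ)
    (hp : ∀ i : Fin n, p i =
      (colNorm (A · i) ^ 2 / frobNorm A ^ 2 + colNorm (B · i) ^ 2 / frobNorm B ^ 2) / 2) :
    (∑ i : Fin n, (1 / p i) * colNorm (A · i) ^ 2 * colNorm (B · i) ^ 2)
      ≤ 2 * frobNorm A ^ 2 * frobNorm B ^ 2 := by
  calc _ ≤ ∑ i, 2 * frobNorm A ^ 2 * colNorm (B · i) ^ 2 :=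
        Finset.sum_le_sum fun i _ ↦ mul_le_mul_of_nonneg_right
          (one_div_mul_le_two_mul (sq_nonneg _) (colNorm_sq_le_frobNorm_sq A i)
            (by positivity) (hp i)) (sq_nonneg _)
    _ = _ := by rw [← Finset.mul_sum, sum_colNorm_sq]
end
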